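/- There exists a universal constant c > 0 such that for every series-parallel poset S, QLB(S) ≥ c · ln(|Δ(S)|). -/

import Mathlib

open MeasureTheory Finset

attribute [local instance] Classical.propDecidable

noncomputable def harm (q : ℕ) : ℝ := ∑ m ∈ Finset.range q, (1 : ℝ) / (m + 1)

noncomputable def linExts (α : Type) [Fintype α] (r : α → α → Prop) :
    Finset (α ≃ Fin (Fintype.card α)) :=
  Finset.univ.filter fun σ => ∀ i j : α, r i j → σ i ≤ σ j

noncomputable def dN {α : Type} [Fintype α] (r : α → α → Prop)
    (σ : α ≃ Fin (Fintype.card α)) (i : α) : ℕ :=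
  if ∀ j : α, r j i → j = i then (σ i : ℕ) + 1
  else sInf {m : ℕ | ∃ j : α, j ≠ i ∧ r j i ∧ m = (σ i : ℕ) - (σ j : ℕ)}

noncomputable def QLB (α : Type) [Fintype α] (r : α → α → Prop) : ℝ :=
  (∑ σ ∈ linExts α r, ∑ i : α, harm (dN r σ i - 1)) / ((linExts α r).card : ℝ)

def chainPolytope (α : Type) [Fintype α] (r : α → α → Prop) : Set (α → ℝ) :=
  {y | (∀ i, 0 ≤ y i) ∧
    ∀ C : Finset α, (∀ i ∈ C, ∀ j ∈ C, r i j ∨ r j i) → ∑ i ∈ C, y i ≤ 1}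

def orderPolytope (α : Type) [Fintype α] (r : α → α → Prop) : Set (α → ℝ) :=
  {y | (∀ i, 0 ≤ y i ∧ y i ≤ 1) ∧ ∀ i j : α, r i j → y i ≤ y j}

noncomputable def transferMap (α : Type) [Fintype α] (r : α → α → Prop)
    (y : α → ℝ) (i : α) : ℝ :=
  if ∀ j : α, r j i → j = i then y i
  else sInf {t : ℝ | ∃ j : α, j ≠ i ∧ r j i ∧ t = y i - y j}

noncomputable def QH (α : Type) [Fintype α] (r : α → α → Prop) : ℝ :=
  ⨍ z in chainPolytope α r, -(1 / (Fintype.card α : ℝ)) * ∑ i : α, Real.log (z i)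

noncomputable def posetEntropy (α : Type) [Fintype α] (r : α → α → Prop) : ℝ :=
  sInf {x : ℝ | ∃ z ∈ chainPolytope α r, (∀ i, 0 < z i) ∧
    x = -(1 / (Fintype.card α : ℝ)) * ∑ i : α, Real.log (z i)}

def seriesComp {α β : Type} (r : α → α → Prop) (s : β → β → Prop) :
    α ⊕ β → α ⊕ β → Prop
  | Sum.inl x, Sum.inl y => r x y
  | Sum.inr x, Sum.inr y => s x y
  | Sum.inl _, Sum.inr _ => True
  | Sum.inr _, Sum.inl _ => False

def parallelComp {α β : Type} (r : α → α → Prop) (s : β → β → Prop) :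
    α ⊕ β → α ⊕ β → Prop
  | Sum.inl x, Sum.inl y => r x y
  | Sum.inr x, Sum.inr y => s x y
  | _, _ => False

inductive SPTree : Type
  | leaf : SPTree
  | series : SPTree → SPTree → SPTree
  | parallel : SPTree → SPTree → SPTree

def SPTree.carrier : SPTree → Type
  | .leaf => Unit
  | .series l r => l.carrier ⊕ r.carrier
  | .parallel l r => l.carrier ⊕ r.carrier

def SPTree.rel : (t : SPTree) → t.carrier → t.carrier → Prop
  | .leaf => fun _ _ => True
  | .series l r => seriesComp l.rel r.rel
  | .parallel l r => parallelComp l.rel r.rel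

/-- `r` is (order-isomorphic to) a series-parallel poset. -/
def IsSeriesParallel (α : Type) (r : α → α → Prop) : Prop :=
  ∃ (t : SPTree) (e : α ≃ t.carrier), ∀ x y : α, r x y ↔ t.rel (e x) (e y)

/-- Injective monotone placements of the elements of `α` in `N` consecutive slots. -/
def Placement {α : Type} (r : α → α → Prop) (N : ℕ) : Type :=
  {s : α → Fin N // Function.Injective s ∧ ∀ i j, r i j → s i ≤ s j}

namespace Placement

variable {α β : Type} {r : α → α → Prop} {s : β → β → Prop} {N : ℕ}

instance [Finite α] : Finite (Placement r N) :=
  inferInstanceAs (Finite {s : α → Fin N // Function.Injective s ∧ ∀ i j, r i j → s i ≤ s j})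

noncomputable instance [Finite α] : Fintype (Placement r N) := Fintype.ofFinite _

/-- The slot `q` lies after all strict predecessors of `i`, and not after `i`. -/
def Window (r : α → α → Prop) (f : α → Fin N) (i : α) (q : Fin N) : Prop :=
  q ≤ f i ∧ ∀ j, j ≠ i → r j i → f j < q

/-- The number of slots between `i` and its latest strict predecessor. -/
noncomputable def gap (r : α → α → Prop) (f : α → Fin N) (i : α) : ℕ :=
  ∑ q : Fin N, if Window r f i q then 1 else 0

/-- The sum over all placements of the harmonic numbers of the gaps. -/
noncomputable def total [Fintype α] (r : α → α → Prop) (N : ℕ) : ℝ :=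
  ∑ f : Placement r N, ∑ i : α, harm (gap r f.1 i - 1)

lemma gap_pos (f : Placement r N) (i : α) : 0 < gap r f.1 i := by
  unfold gap
  refine Finset.sum_pos' (fun _ _ => Nat.zero_le _) ⟨f.1 i, Finset.mem_univ _, ?_⟩
  rw [if_pos]
  · exact one_pos
  · exact ⟨le_rfl, fun j hj hr => lt_of_le_of_ne (f.2.2 _ _ hr) fun h => hj (f.2.1 h)⟩

/-! ### Inserting an empty slot -/

/-- Insert an empty slot at `p`. -/
def insertSlot (f : Placement r N) (p : Fin (N + 1)) : Placement r (N + 1) :=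
  ⟨fun i => p.succAbove (f.1 i), fun _ _ h => f.2.1 (Fin.succAbove_right_injective h),
    fun i j h => (Fin.strictMono_succAbove p).monotone (f.2.2 i j h)⟩

lemma gap_insertSlot (f : Placement r N) (p : Fin (N + 1)) (i : α) :
    gap r (insertSlot f p).1 i = (if p ≤ (f.1 i).castSucc ∧
      ∀ j, j ≠ i → r j i → (f.1 j).castSucc < p then 1 else 0) + gap r f.1 i := by
  unfold gap
  rw [Fin.sum_univ_succAbove _ p]
  congr 1
  · congr 1
    simp only [Window, insertSlot, eq_iff_iff]
    refine and_congr ?_ (forall_congr' fun j => imp_congr_right fun _ => imp_congr_right fun _ =>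
      Fin.succAbove_lt_iff_castSucc_lt p (f.1 j))
    rw [← Fin.lt_succAbove_iff_le_castSucc]
    exact ⟨fun h => lt_of_le_of_ne h (Fin.succAbove_ne _ _).symm, le_of_lt⟩
  · refine Finset.sum_congr rfl fun q _ => ?_
    congr 1
    simp only [Window, insertSlot, Fin.succAbove_le_succAbove_iff,
      Fin.succAbove_lt_succAbove_iff]

lemma sum_window_castSucc (f : α → Fin N) (i : α) :
    (∑ p : Fin (N + 1), if p ≤ (f i).castSucc ∧
      ∀ j, j ≠ i → r j i → (f j).castSucc < p then 1 else 0) = gap r f i := by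
  rw [Fin.sum_univ_castSucc, if_neg, add_zero]
  · exact Finset.sum_congr rfl fun q _ => if_congr Iff.rfl rfl rfl
  · rintro ⟨h, -⟩
    exact absurd h (not_le.2 (Fin.castSucc_lt_last _))

lemma harm_succ (q : ℕ) : harm (q + 1) = harm q + 1 / (q + 1) := by
  simp [harm, Finset.sum_range_succ]

lemma sum_harm_insertSlot (f : Placement r N) (i : α) :
    ∑ p : Fin (N + 1), harm (gap r (insertSlot f p).1 i - 1) =
      (N + 1) * harm (gap r f.1 i - 1) + 1 := by
  obtain ⟨g, hg⟩ : ∃ g, gap r f.1 i = g + 1 := ⟨_, (Nat.sub_add_cancel (gap_pos f i)).symm⟩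
  have key : ∀ p : Fin (N + 1), harm (gap r (insertSlot f p).1 i - 1) = harm g +
      ((if p ≤ (f.1 i).castSucc ∧
        ∀ j, j ≠ i → r j i → (f.1 j).castSucc < p then 1 else 0 : ℕ) : ℝ) * (1 / (g + 1)) := by
    intro p
    rw [gap_insertSlot, hg]
    split_ifs
    · rw [show 1 + (g + 1) - 1 = g + 1 by omega, harm_succ]
      simp
    · simp
  rw [Finset.sum_congr rfl fun p _ => key p, Finset.sum_add_distrib, ← Finset.sum_mul,
    ← Nat.cast_sum, sum_window_castSucc, hg]
  have : (g : ℝ) + 1 ≠ 0 := by positivity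
  simp
  field_simp

lemma insertSlot_bijective : Function.Bijective
    (fun x : Placement r N × Fin (N + 1) =>
      (⟨insertSlot x.1 x.2, x.2, fun h => by
        obtain ⟨i, hi⟩ := h
        exact Fin.succAbove_ne _ _ hi⟩ :
        Σ f : Placement r (N + 1), {p : Fin (N + 1) // p ∉ Set.range f.1})) := by
  constructor
  · rintro ⟨f, p⟩ ⟨f', p'⟩ h
    have h1 : insertSlot f p = insertSlot f' p' := congrArg Sigma.fst h
    have h2 : p = p' :=
      congrArg (fun x : Σ f : Placement r (N + 1), {p : Fin (N + 1) // p ∉ Set.range f.1} =>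
        x.2.1) h
    subst h2
    congr 1
    apply Subtype.ext
    funext i
    exact Fin.succAbove_right_injective (congrFun (congrArg Subtype.val h1) i)
  · rintro ⟨f, p, hp⟩
    have hne : ∀ i, ∃ q, p.succAbove q = f.1 i := fun i =>
      Fin.exists_succAbove_eq fun h => hp ⟨i, h⟩
    choose g hg using hne
    obtain ⟨g', rfl⟩ : ∃ g' : Placement r N, insertSlot g' p = f := by
      refine ⟨⟨g, fun i j h => f.2.1 (by rw [← hg, ← hg, h]), fun i j h => ?_⟩,
        Subtype.ext (funext hg)⟩
      have := f.2.2 i j h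
      rwa [← hg, ← hg, Fin.succAbove_le_succAbove_iff] at this
    exact ⟨(g', p), rfl⟩

lemma sum_insertSlot [Fintype α] (F : Placement r (N + 1) → ℝ) :
    ∑ f : Placement r N, ∑ p, F (insertSlot f p) =
      ((N + 1 : ℝ) - Fintype.card α) * ∑ f, F f := by
  rw [← Fintype.sum_prod_type']
  rw [Fintype.sum_bijective _ insertSlot_bijective (fun x => F (insertSlot x.1 x.2))
    (fun x => F x.1) (fun _ => rfl)]
  rw [Fintype.sum_sigma, Finset.mul_sum]
  refine Finset.sum_congr rfl fun f _ => ?_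
  have hc : Fintype.card {p : Fin (N + 1) // p ∉ Set.range f.1} + Fintype.card α = N + 1 := by
    have h1 := Fintype.card_subtype_compl (fun p : Fin (N + 1) => p ∈ Set.range f.1)
    have h2 : Fintype.card {p : Fin (N + 1) // p ∈ Set.range f.1} = Fintype.card α :=
      Set.card_range_of_injective f.2.1
    have h3 := Fintype.card_le_of_injective _ f.2.1
    rw [Fintype.card_fin] at h1 h3
    omega
  have hc' : (Fintype.card {p : Fin (N + 1) // p ∉ Set.range f.1} : ℝ) =
      (N + 1 : ℝ) - Fintype.card α := by
    rw [eq_sub_iff_add_eq]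
    exact_mod_cast hc
  simp [← hc']

lemma card_succ [Fintype α] :
    ((N + 1 : ℝ) - Fintype.card α) * Fintype.card (Placement r (N + 1)) =
      (N + 1) * Fintype.card (Placement r N) := by
  have := sum_insertSlot (r := r) (N := N) fun _ => 1
  simp only [Finset.sum_const, Finset.card_univ, nsmul_eq_mul, mul_one, Fintype.card_fin] at this
  rw [← this]
  push_cast
  ring

lemma total_succ [Fintype α] :
    ((N + 1 : ℝ) - Fintype.card α) * total r (N + 1) =
      (N + 1) * total r N + Fintype.card α * Fintype.card (Placement r N) := by
  unfold total
  rw [← sum_insertSlot]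
  have : ∀ f : Placement r N, ∑ p, ∑ i, harm (gap r (insertSlot f p).1 i - 1) =
      (N + 1) * (∑ i, harm (gap r f.1 i - 1)) + Fintype.card α := by
    intro f
    rw [Finset.sum_comm, Finset.sum_congr rfl fun i _ => sum_harm_insertSlot f i,
      Finset.sum_add_distrib, ← Finset.mul_sum]
    simp
  rw [Finset.sum_congr rfl fun f _ => this f, Finset.sum_add_distrib, ← Finset.mul_sum]
  simp [mul_comm]

lemma card_add [Fintype α] (m : ℕ) :
    Fintype.card (Placement r (Fintype.card α + m)) =
      (Fintype.card α + m).choose m * Fintype.card (Placement r (Fintype.card α)) := by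
  induction m with
  | zero => simp
  | succ m ih =>
    have h := card_succ (r := r) (N := Fintype.card α + m)
    have hp : (0 : ℝ) < m + 1 := by positivity
    have hch := Nat.add_one_mul_choose_eq (Fintype.card α + m) m
    rw [ih] at h
    have hch' : ((Fintype.card α : ℝ) + m + 1) * ((Fintype.card α + m).choose m : ℝ) =
        ((Fintype.card α + (m + 1)).choose (m + 1) : ℝ) * (m + 1) := by exact_mod_cast hch
    push_cast at h
    have : (m + 1 : ℝ) * Fintype.card (Placement r (Fintype.card α + (m + 1))) = (m + 1) *
      ((Fintype.card α + (m + 1)).choose (m + 1) *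
        Fintype.card (Placement r (Fintype.card α))) := by
      rw [← mul_assoc, mul_comm (m + 1 : ℝ) ((Nat.choose _ _ : ℕ) : ℝ), ← hch']
      linear_combination h
    exact_mod_cast mul_left_cancel₀ hp.ne' this

lemma total_add [Fintype α] (m : ℕ) :
    total r (Fintype.card α + m) = (Fintype.card α + m).choose m *
      (total r (Fintype.card α) + Fintype.card (Placement r (Fintype.card α)) *
        (Fintype.card α * (harm (Fintype.card α + m) - harm (Fintype.card α)))) := by
  induction m with
  | zero => simp
  | succ m ih =>
    have h := total_succ (r := r) (N := Fintype.card α + m)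
    have hp : (0 : ℝ) < m + 1 := by positivity
    have hch := Nat.add_one_mul_choose_eq (Fintype.card α + m) m
    rw [ih, card_add] at h
    have hch' : ((Fintype.card α : ℝ) + m + 1) * ((Fintype.card α + m).choose m : ℝ) =
        ((Fintype.card α + (m + 1)).choose (m + 1) : ℝ) * (m + 1) := by exact_mod_cast hch
    push_cast at h
    refine mul_left_cancel₀ hp.ne' ?_
    rw [← mul_assoc, mul_comm (m + 1 : ℝ) ((Nat.choose _ _ : ℕ) : ℝ), ← hch', ← add_assoc,
      harm_succ]
    have hne : ((Fintype.card α : ℝ) + m + 1) ≠ 0 := by positivity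
    push_cast
    field_simp
    linear_combination h

/-! ### Transport along isomorphisms -/

/-- Placements transported along an isomorphism of relations. -/
def congr (e : α ≃ β) (h : ∀ x y, r x y ↔ s (e x) (e y)) (N : ℕ) :
    Placement r N ≃ Placement s N where
  toFun f := ⟨fun b => f.1 (e.symm b), fun _ _ hb => e.symm.injective (f.2.1 hb),
    fun i j hij => f.2.2 _ _ ((h _ _).2 (by simpa using hij))⟩
  invFun f := ⟨fun a => f.1 (e a), fun _ _ ha => e.injective (f.2.1 ha),
    fun i j hij => f.2.2 _ _ ((h _ _).1 hij)⟩
  left_inv f := Subtype.ext (funext fun a => by simp)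
  right_inv f := Subtype.ext (funext fun a => by simp)

lemma gap_congr (e : α ≃ β) (h : ∀ x y, r x y ↔ s (e x) (e y)) (f : Placement r N) (i : α) :
    gap s (congr e h N f).1 (e i) = gap r f.1 i := by
  unfold gap
  refine Finset.sum_congr rfl fun q _ => if_congr ?_ rfl rfl
  have hc : ∀ j, (congr e h N f).1 (e j) = f.1 j := fun j =>
    congrArg f.1 (e.symm_apply_apply j)
  unfold Window
  rw [hc, ← e.forall_congr_right]
  simp only [hc, ← h, ne_eq, EmbeddingLike.apply_eq_iff_eq]

lemma total_congr [Fintype α] [Fintype β] (e : α ≃ β) (h : ∀ x y, r x y ↔ s (e x) (e y)) :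
    total r N = total s N := by
  unfold total
  refine Fintype.sum_equiv (congr e h N) _ _ fun f => ?_
  exact Fintype.sum_equiv e _ _ fun i => by rw [gap_congr]

/-! ### Comparison with linear extensions -/

/-- A linear extension viewed as a placement without empty slots. -/
noncomputable def ofLinExt [Fintype α] :
    linExts α r ≃ Placement r (Fintype.card α) where
  toFun σ := ⟨σ.1, σ.1.injective, (Finset.mem_filter.1 σ.2).2⟩
  invFun f := ⟨Equiv.ofBijective f.1
      ((Fintype.bijective_iff_injective_and_card _).2 ⟨f.2.1, by simp⟩),
    Finset.mem_filter.2 ⟨Finset.mem_univ _, f.2.2⟩⟩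
  left_inv σ := Subtype.ext (Equiv.ext fun _ => rfl)
  right_inv f := rfl

lemma gap_eq_dN [Fintype α] (σ : α ≃ Fin (Fintype.card α)) (hσ : σ ∈ linExts α r) (i : α) :
    gap r σ i = dN r σ i := by
  have hm : ∀ i j, r i j → σ i ≤ σ j := (Finset.mem_filter.1 hσ).2
  unfold gap dN
  rw [← Finset.card_filter]
  split_ifs with h
  · have : (Finset.univ.filter fun q => Window r σ i q) = Finset.Iic (σ i) := by
      ext q
      rw [Finset.mem_filter, Finset.mem_Iic]
      refine ⟨fun h => h.2.1, fun hq => ⟨Finset.mem_univ _, hq, ?_⟩⟩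
      exact fun j hj hr => absurd (h j hr) hj
    rw [this, Fin.card_Iic]
  · push Not at h
    obtain ⟨j₀, hj₀, hne₀⟩ := h
    obtain ⟨j, hj, hmax⟩ := Finset.exists_max_image
      (Finset.univ.filter fun j => j ≠ i ∧ r j i) σ ⟨j₀, by simp [hj₀, hne₀]⟩
    simp only [Finset.mem_filter, Finset.mem_univ, true_and] at hj hmax
    have : (Finset.univ.filter fun q => Window r σ i q) = Finset.Ioc (σ j) (σ i) := by
      ext q
      rw [Finset.mem_filter, Finset.mem_Ioc]
      exact ⟨fun h => ⟨h.2.2 j hj.1 hj.2, h.2.1⟩,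
        fun h => ⟨Finset.mem_univ _, h.2, fun k hk hr => (hmax k ⟨hk, hr⟩).trans_lt h.1⟩⟩
    rw [this, Fin.card_Ioc]
    symm
    apply IsLeast.csInf_eq
    refine ⟨⟨j, hj.1, hj.2, rfl⟩, ?_⟩
    rintro _ ⟨k, hk, hr, rfl⟩
    have := hmax k ⟨hk, hr⟩
    have := Fin.le_def.1 this
    omega

lemma card_linExts [Fintype α] :
    (linExts α r).card = Fintype.card (Placement r (Fintype.card α)) := by
  rw [← Fintype.card_coe]
  exact Fintype.card_congr ofLinExt

lemma QLB_eq [Fintype α] :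
    QLB α r = total r (Fintype.card α) / Fintype.card (Placement r (Fintype.card α)) := by
  unfold QLB total
  rw [card_linExts]
  congr 1
  rw [← Finset.sum_coe_sort]
  refine Fintype.sum_equiv ofLinExt _ _ fun σ => ?_
  exact Finset.sum_congr rfl fun i _ => by rw [← gap_eq_dN σ.1 σ.2]; rfl

/-! ### Parallel composition -/

lemma parallelComp_swap (x y : α ⊕ β) :
    parallelComp r s x y ↔
      parallelComp s r (Equiv.sumComm α β x) (Equiv.sumComm α β y) := by
  rcases x with x | x <;> rcases y with y | y <;> rfl

variable [Fintype α] [Fintype β]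

lemma card_compl_image (f : Placement r (Fintype.card α + Fintype.card β)) :
    (Finset.univ.image f.1)ᶜ.card = Fintype.card β := by
  rw [Finset.card_compl, Finset.card_image_of_injective _ f.2.1]
  simp

/-- Fill the empty slots of a placement of `α` with a linear extension of `β`. -/
noncomputable def shuffle
    (x : Placement r (Fintype.card α + Fintype.card β) × Placement s (Fintype.card β)) :
    Placement (parallelComp r s) (Fintype.card α + Fintype.card β) :=
  ⟨Sum.elim x.1.1 fun b =>
      (Finset.univ.image x.1.1)ᶜ.orderEmbOfFin (card_compl_image x.1) (x.2.1 b), by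
    have hmem : ∀ b, (Finset.univ.image x.1.1)ᶜ.orderEmbOfFin (card_compl_image x.1) b ∈
      (Finset.univ.image x.1.1)ᶜ := fun b => Finset.orderEmbOfFin_mem _ _ _
    simp only [Finset.mem_compl, Finset.mem_image, Finset.mem_univ, true_and, not_exists] at hmem
    constructor
    · exact x.1.2.1.sumElim (fun b c h => x.2.2.1 ((RelEmbedding.injective _) h))
        fun a b => hmem _ _
    · rintro (a | a) (b | b) h
      · exact x.1.2.2 _ _ h
      · exact h.elim
      · exact h.elim
      · exact (OrderEmbedding.monotone _) (x.2.2.2 _ _ h)⟩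

lemma shuffle_bijective : Function.Bijective (shuffle (r := r) (s := s)) := by
  constructor
  · rintro ⟨f, g⟩ ⟨f', g'⟩ h
    have h1 : f = f' := Subtype.ext (funext fun a => congrFun (congrArg Subtype.val h) (Sum.inl a))
    subst h1
    congr 1
    refine Subtype.ext (funext fun b => ?_)
    exact (RelEmbedding.injective _) (congrFun (congrArg Subtype.val h) (Sum.inr b))
  · intro σ
    let f : Placement r (Fintype.card α + Fintype.card β) :=
      ⟨fun a => σ.1 (Sum.inl a), fun a b h => Sum.inl_injective (σ.2.1 h),
        fun a b h => σ.2.2 _ _ h⟩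
    have hex : ∀ b, ∃ k, (Finset.univ.image f.1)ᶜ.orderEmbOfFin (card_compl_image f) k =
        σ.1 (Sum.inr b) := by
      intro b
      rw [← Set.mem_range, Finset.range_orderEmbOfFin]
      simp only [Finset.coe_compl, Finset.coe_image, Set.mem_compl_iff, Set.mem_image, not_exists]
      rintro a ⟨-, h⟩
      exact Sum.inl_ne_inr (σ.2.1 h)
    choose g hg using hex
    let g' : Placement s (Fintype.card β) :=
      ⟨g, fun a b h => Sum.inr_injective (σ.2.1 (by rw [← hg, ← hg, h])), fun a b h => by
        have := σ.2.2 (Sum.inr a) (Sum.inr b) h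
        rwa [← hg, ← hg, OrderEmbedding.le_iff_le] at this⟩
    refine ⟨(f, g'), Subtype.ext (funext ?_)⟩
    rintro (a | b)
    · rfl
    · exact hg b

lemma gap_shuffle_inl
    (x : Placement r (Fintype.card α + Fintype.card β) × Placement s (Fintype.card β)) (a : α) :
    gap (parallelComp r s) (shuffle x).1 (Sum.inl a) = gap r x.1.1 a := by
  unfold gap
  refine Finset.sum_congr rfl fun q _ => ?_
  congr 1
  simp [Window, shuffle, parallelComp]

lemma card_parallel :
    Fintype.card (Placement (parallelComp r s) (Fintype.card α + Fintype.card β)) =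
      Fintype.card (Placement r (Fintype.card α + Fintype.card β)) *
        Fintype.card (Placement s (Fintype.card β)) := by
  rw [← Fintype.card_prod]
  exact (Fintype.card_of_bijective shuffle_bijective).symm

lemma sum_inl_parallel :
    ∑ σ : Placement (parallelComp r s) (Fintype.card α + Fintype.card β),
      ∑ a : α, harm (gap (parallelComp r s) σ.1 (Sum.inl a) - 1) =
      total r (Fintype.card α + Fintype.card β) * Fintype.card (Placement s (Fintype.card β)) := by
  rw [← Fintype.sum_bijective _ shuffle_bijective
    (fun x => ∑ a : α, harm (gap r x.1.1 a - 1)) _ fun x => by simp only [gap_shuffle_inl]]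
  rw [Fintype.sum_prod_type]
  simp [total, mul_comm, Finset.mul_sum]

lemma total_parallel :
    total (parallelComp r s) (Fintype.card α + Fintype.card β) =
      total r (Fintype.card α + Fintype.card β) * Fintype.card (Placement s (Fintype.card β)) +
      total s (Fintype.card β + Fintype.card α) *
        Fintype.card (Placement r (Fintype.card α)) := by
  rw [← sum_inl_parallel, ← sum_inl_parallel, total]
  simp only [Fintype.sum_sum_type, Finset.sum_add_distrib]
  congr 1
  rw [add_comm (Fintype.card β)]
  refine Fintype.sum_equiv (congr (Equiv.sumComm α β) parallelComp_swap _) _ _ fun f => ?_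
  refine Finset.sum_congr rfl fun b _ => ?_
  rw [← gap_congr (Equiv.sumComm α β) parallelComp_swap]
  rfl

/-! ### Series composition -/

/-- Place a linear extension of `β` after one of `α`. -/
def append (x : Placement r (Fintype.card α) × Placement s (Fintype.card β)) :
    Placement (seriesComp r s) (Fintype.card α + Fintype.card β) :=
  ⟨Sum.elim (fun a => Fin.castAdd _ (x.1.1 a)) (fun b => Fin.natAdd _ (x.2.1 b)), by
    constructor
    · refine Function.Injective.sumElim (fun a b h => x.1.2.1 (Fin.castAdd_injective _ _ h))
        (fun a b h => x.2.2.1 (Fin.natAdd_injective _ _ h)) fun a b h => ?_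
      have := congrArg Fin.val h
      simp only [Fin.val_castAdd, Fin.val_natAdd] at this
      omega
    · rintro (a | a) (b | b) h
      · exact Fin.le_def.2 (Fin.le_def.1 (x.1.2.2 _ _ h))
      · simp only [Sum.elim_inl, Sum.elim_inr, Fin.le_def, Fin.val_castAdd, Fin.val_natAdd]
        omega
      · exact h.elim
      · simpa using x.2.2.2 _ _ h⟩

lemma series_inl_lt (σ : Placement (seriesComp r s) (Fintype.card α + Fintype.card β)) (a : α) :
    (σ.1 (Sum.inl a) : ℕ) < Fintype.card α := by
  have hinj : Function.Injective fun b : β => σ.1 (Sum.inr b) :=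
    fun b c h => Sum.inr_injective (σ.2.1 h)
  have h : Finset.univ.image (fun b : β => σ.1 (Sum.inr b)) ⊆ Finset.Ioi (σ.1 (Sum.inl a)) := by
    intro q hq
    obtain ⟨b, -, rfl⟩ := Finset.mem_image.1 hq
    exact Finset.mem_Ioi.2 (lt_of_le_of_ne (σ.2.2 (Sum.inl a) (Sum.inr b) trivial)
      fun h => Sum.inl_ne_inr (σ.2.1 h))
  have := Finset.card_le_card h
  rw [Finset.card_image_of_injective _ hinj, Finset.card_univ, Fin.card_Ioi] at this
  omega

lemma series_le_inr (σ : Placement (seriesComp r s) (Fintype.card α + Fintype.card β)) (b : β) :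
    Fintype.card α ≤ (σ.1 (Sum.inr b) : ℕ) := by
  have hinj : Function.Injective fun a : α => σ.1 (Sum.inl a) :=
    fun b c h => Sum.inl_injective (σ.2.1 h)
  have h : Finset.univ.image (fun a : α => σ.1 (Sum.inl a)) ⊆ Finset.Iio (σ.1 (Sum.inr b)) := by
    intro q hq
    obtain ⟨a, -, rfl⟩ := Finset.mem_image.1 hq
    exact Finset.mem_Iio.2 (lt_of_le_of_ne (σ.2.2 (Sum.inl a) (Sum.inr b) trivial)
      fun h => Sum.inl_ne_inr (σ.2.1 h))
  have := Finset.card_le_card h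
  rwa [Finset.card_image_of_injective _ hinj, Finset.card_univ, Fin.card_Iio] at this

lemma append_bijective : Function.Bijective (append (r := r) (s := s)) := by
  constructor
  · rintro ⟨f, g⟩ ⟨f', g'⟩ h
    congr 1
    · exact Subtype.ext (funext fun a =>
        Fin.castAdd_injective _ _ (congrFun (congrArg Subtype.val h) (Sum.inl a)))
    · exact Subtype.ext (funext fun b =>
        Fin.natAdd_injective _ _ (congrFun (congrArg Subtype.val h) (Sum.inr b)))
  · intro σ
    have hf : ∀ a, ∃ k, Fin.castAdd (Fintype.card β) k = σ.1 (Sum.inl a) := fun a =>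
      ⟨⟨σ.1 (Sum.inl a), series_inl_lt σ a⟩, rfl⟩
    have hg : ∀ b, ∃ k, Fin.natAdd (Fintype.card α) k = σ.1 (Sum.inr b) := fun b =>
      ⟨⟨σ.1 (Sum.inr b) - Fintype.card α, by have := series_le_inr σ b; omega⟩, by
        have := series_le_inr σ b
        ext
        simp only [Fin.val_natAdd]
        omega⟩
    choose f hf using hf
    choose g hg using hg
    let f' : Placement r (Fintype.card α) :=
      ⟨f, fun a b h => Sum.inl_injective (σ.2.1 (by rw [← hf, ← hf, h])), fun a b h => by
        have := σ.2.2 (Sum.inl a) (Sum.inl b) h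
        rw [← hf, ← hf] at this
        exact Fin.le_def.2 (Fin.le_def.1 this)⟩
    let g' : Placement s (Fintype.card β) :=
      ⟨g, fun a b h => Sum.inr_injective (σ.2.1 (by rw [← hg, ← hg, h])), fun a b h => by
        have := σ.2.2 (Sum.inr a) (Sum.inr b) h
        rw [← hg, ← hg] at this
        simpa using this⟩
    refine ⟨(f', g'), Subtype.ext (funext ?_)⟩
    rintro (a | b)
    · exact hf a
    · exact hg b

lemma gap_append_inl (x : Placement r (Fintype.card α) × Placement s (Fintype.card β)) (a : α) :
    gap (seriesComp r s) (append x).1 (Sum.inl a) = gap r x.1.1 a := by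
  unfold gap
  rw [Fin.sum_univ_add]
  conv_rhs => rw [← add_zero (∑ _, _)]
  congr 1
  · refine Finset.sum_congr rfl fun q _ => ?_
    congr 1
    simp only [Window, append, seriesComp, Sum.forall, Sum.elim_inl, Fin.lt_def, Fin.le_def,
      Fin.val_castAdd, ne_eq, Sum.inl.injEq, false_imp_iff, implies_true, and_true]
  · refine Finset.sum_eq_zero fun q _ => if_neg ?_
    rintro ⟨h, -⟩
    have := Fin.le_def.1 h
    simp only [append, Sum.elim_inl, Fin.val_castAdd, Fin.val_natAdd] at this
    omega

lemma gap_append_inr (x : Placement r (Fintype.card α) × Placement s (Fintype.card β)) (b : β) :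
    gap (seriesComp r s) (append x).1 (Sum.inr b) = gap s x.2.1 b := by
  unfold gap
  rw [Fin.sum_univ_add]
  conv_rhs => rw [← zero_add (∑ _, _)]
  congr 1
  · refine Finset.sum_eq_zero fun q _ => if_neg ?_
    rintro ⟨-, h⟩
    obtain ⟨a, ha⟩ := ((Fintype.bijective_iff_injective_and_card _).2 ⟨x.1.2.1, by simp⟩).2 q
    have := h (Sum.inl a) Sum.inl_ne_inr trivial
    simp [append, ha] at this
  · refine Finset.sum_congr rfl fun q _ => ?_
    congr 1
    simp only [Window, append, seriesComp, Sum.forall, Sum.elim_inl, Sum.elim_inr, Fin.lt_def,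
      Fin.le_def, Fin.val_castAdd, Fin.val_natAdd, eq_iff_iff]
    refine and_congr (by omega) ⟨fun h j hj hr => ?_, fun h => ⟨fun a _ _ => by omega, ?_⟩⟩
    · have := h.2 j (fun e => hj (Sum.inr_injective e)) hr
      omega
    · intro j hj hr
      have := h j (fun e => hj (congrArg _ e)) hr
      omega

lemma card_series :
    Fintype.card (Placement (seriesComp r s) (Fintype.card α + Fintype.card β)) =
      Fintype.card (Placement r (Fintype.card α)) *
        Fintype.card (Placement s (Fintype.card β)) := by
  rw [← Fintype.card_prod]
  exact (Fintype.card_of_bijective append_bijective).symm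

lemma total_series :
    total (seriesComp r s) (Fintype.card α + Fintype.card β) =
      total r (Fintype.card α) * Fintype.card (Placement s (Fintype.card β)) +
      total s (Fintype.card β) * Fintype.card (Placement r (Fintype.card α)) := by
  rw [total, ← Fintype.sum_bijective _ append_bijective
    (fun x => ∑ a : α, harm (gap r x.1.1 a - 1) + ∑ b : β, harm (gap s x.2.1 b - 1)) _
    fun x => by simp only [Fintype.sum_sum_type, gap_append_inl, gap_append_inr]]
  rw [Fintype.sum_prod_type]
  simp only [Finset.sum_add_distrib, Finset.sum_const, Finset.card_univ, nsmul_eq_mul,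
    ← Finset.mul_sum, total]
  ring

end Placement

open Placement

lemma log_div_le_harm_sub (m n : ℕ) :
    Real.log ((n + m + 1) / (m + 1)) ≤ harm (n + m) - harm m := by
  induction n with
  | zero =>
    have : (m + 1 : ℝ) ≠ 0 := by positivity
    simp [div_self this]
  | succ n ih =>
    have h1 : Real.log ((n + 1 + m + 1) / (m + 1)) =
        Real.log ((n + m + 1) / (m + 1)) + Real.log ((n + 1 + m + 1) / (n + m + 1)) := by
      rw [← Real.log_mul (by positivity) (by positivity)]
      congr 1
      field_simp
    have h2 : Real.log (((n : ℝ) + 1 + m + 1) / (n + m + 1)) ≤ 1 / (n + m + 1) := by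
      refine (Real.log_le_sub_one_of_pos (by positivity)).trans (le_of_eq ?_)
      field_simp
      ring
    rw [show n + 1 + m = n + m + 1 by ring, harm_succ]
    push_cast
    linarith

lemma log_choose_le (n m : ℕ) :
    Real.log ((n + m).choose m) ≤
      n * (harm (n + m) - harm n) + m * (harm (m + n) - harm m) := by
  induction m with
  | zero => simp
  | succ m ih =>
    have hch := Nat.add_one_mul_choose_eq (n + m) m
    have hch' : ((n + (m + 1)).choose (m + 1) : ℝ) =
        ((n + m).choose m : ℝ) * ((n + m + 1) / (m + 1)) := by
      rw [← mul_div_assoc, eq_div_iff (by positivity),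
        mul_comm ((Nat.choose (n + m) m : ℕ) : ℝ)]
      exact_mod_cast hch.symm
    have hpos : (0 : ℝ) < (n + m).choose m := by
      exact_mod_cast Nat.choose_pos (Nat.le_add_left m n)
    rw [hch', Real.log_mul hpos.ne' (by positivity)]
    have h := log_div_le_harm_sub m n
    rw [add_comm m n] at ih
    rw [show m + 1 + n = n + m + 1 by ring, show n + (m + 1) = n + m + 1 by ring, harm_succ,
      harm_succ]
    refine (add_le_add ih h).trans (le_of_eq ?_)
    push_cast
    field_simp
    ring

/-- A finite relation has a linear extension and `ln |Δ|` is at most the average gap sum. -/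
def LogCardLe {α : Type} [Fintype α] (r : α → α → Prop) : Prop :=
  0 < Fintype.card (Placement r (Fintype.card α)) ∧
    Real.log (Fintype.card (Placement r (Fintype.card α))) ≤
      total r (Fintype.card α) / Fintype.card (Placement r (Fintype.card α))

section

variable {α β : Type} [Fintype α] [Fintype β] {r : α → α → Prop} {s : β → β → Prop}

lemma LogCardLe.series (hr : LogCardLe r) (hs : LogCardLe s) : LogCardLe (seriesComp r s) := by
  obtain ⟨hr0, hr⟩ := hr
  obtain ⟨hs0, hs⟩ := hs
  unfold LogCardLe
  rw [Fintype.card_sum, card_series, total_series]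
  refine ⟨by positivity, ?_⟩
  have hr0' : (0 : ℝ) < Fintype.card (Placement r (Fintype.card α)) := by exact_mod_cast hr0
  have hs0' : (0 : ℝ) < Fintype.card (Placement s (Fintype.card β)) := by exact_mod_cast hs0
  push_cast
  rw [Real.log_mul hr0'.ne' hs0'.ne']
  refine (add_le_add hr hs).trans (le_of_eq ?_)
  field_simp

lemma LogCardLe.parallel (hr : LogCardLe r) (hs : LogCardLe s) :
    LogCardLe (parallelComp r s) := by
  obtain ⟨hr0, hr⟩ := hr
  obtain ⟨hs0, hs⟩ := hs
  unfold LogCardLe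
  have hc : ((Fintype.card β + Fintype.card α).choose (Fintype.card α)) =
      (Fintype.card α + Fintype.card β).choose (Fintype.card β) := by
    rw [add_comm (Fintype.card β), Nat.choose_symm_add]
  have hc0 : 0 < (Fintype.card α + Fintype.card β).choose (Fintype.card β) :=
    Nat.choose_pos (Nat.le_add_left _ _)
  rw [Fintype.card_sum, card_parallel, total_parallel, card_add, total_add, total_add, hc]
  refine ⟨by positivity, ?_⟩
  have hr0' : (0 : ℝ) < Fintype.card (Placement r (Fintype.card α)) := by exact_mod_cast hr0
  have hs0' : (0 : ℝ) < Fintype.card (Placement s (Fintype.card β)) := by exact_mod_cast hs0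
  have hc0' : (0 : ℝ) < (Fintype.card α + Fintype.card β).choose (Fintype.card β) := by
    exact_mod_cast hc0
  push_cast
  rw [Real.log_mul (by positivity) hs0'.ne', Real.log_mul hc0'.ne' hr0'.ne']
  refine (add_le_add (add_le_add (log_choose_le _ _) hr) hs).trans (le_of_eq ?_)
  field_simp
  ring

lemma LogCardLe.of_equiv (e : α ≃ β) (h : ∀ x y, r x y ↔ s (e x) (e y)) (hs : LogCardLe s) :
    LogCardLe r := by
  unfold LogCardLe at *
  rwa [Fintype.card_congr e, total_congr e h, Fintype.card_congr (congr e h _)]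

end

lemma logCardLe_leaf : LogCardLe (fun _ _ : Unit => True) := by
  have hc : Fintype.card (Placement (fun _ _ : Unit => True) (Fintype.card Unit)) = 1 := by
    refine Fintype.card_eq_one_iff.2 ⟨⟨fun _ => 0, fun _ _ _ => rfl, fun _ _ _ => le_rfl⟩,
      fun f => Subtype.ext (funext fun x => ?_)⟩
    have h := (f.1 x).2
    simp only [Fintype.card_unit] at h
    ext
    simp only [Fin.val_zero]
    omega
  unfold LogCardLe
  rw [hc]
  refine ⟨one_pos, ?_⟩
  simp only [Nat.cast_one, Real.log_one, div_one, total]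
  exact Finset.sum_nonneg fun _ _ => Finset.sum_nonneg fun _ _ =>
    Finset.sum_nonneg fun _ _ => by positivity

lemma SPTree.exists_logCardLe (t : SPTree) : ∃ _ : Fintype t.carrier, LogCardLe t.rel := by
  induction t with
  | leaf => exact ⟨inferInstanceAs (Fintype Unit), logCardLe_leaf⟩
  | series l r hl hr =>
    obtain ⟨_, hl⟩ := hl
    obtain ⟨_, hr⟩ := hr
    exact ⟨inferInstanceAs (Fintype (l.carrier ⊕ r.carrier)), hl.series hr⟩
  | parallel l r hl hr =>
    obtain ⟨_, hl⟩ := hl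
    obtain ⟨_, hr⟩ := hr
    exact ⟨inferInstanceAs (Fintype (l.carrier ⊕ r.carrier)), hl.parallel hr⟩

/-- There is a universal `c > 0` such that `QLB(S) ≥ c ln |Δ(S)|`
for every series-parallel poset `S`. -/
theorem stmt_10 : ∃ c : ℝ, 0 < c ∧
    ∀ (α : Type) [Fintype α] (r : α → α → Prop) [IsPartialOrder α r],
      IsSeriesParallel α r →
      c * Real.log ((linExts α r).card) ≤ QLB α r := by
  refine ⟨1, one_pos, fun α _ r _ ⟨t, e, h⟩ => ?_⟩
  obtain ⟨_, ht⟩ := t.exists_logCardLe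
  rw [one_mul, card_linExts, QLB_eq]
  exact (ht.of_equiv e h).2
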